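/- Let f : (C•,d_C) → (D•,d_D) be a cochain map between cochain complexes in 𝒞 with fixed lifts (C̄•,d̄_C), (D̄•,d̄_D) along F. Then: (Surjectivity) for every cochain map g : (C•,d_C) → (D•,d_D) homotopic to f and every cochain map ḡ : (C̄•,d̄_C) → (D̄•,d̄_D) with F(ḡ) = g, there exists a cochain map f̄ with F(f̄) = f and a homotopy f̄ → ḡ lifting a homotopy f → g; in particular the natural map from homotopy classes of cochain-map lifts of f to morphisms of the homotopy category K(𝒞̄) lifting the homotopy class of f is surjective. (Injectivity) If every graded map of degree −1 from C• to D• that is a δ-cycle is a δ-coboundary (i.e. H^{−1} of the Hom-complex Hom•(C•,D•) vanishes), then whenever f̄ and f̄′ are cochain maps lifting f that are homotopic in 𝒞̄, there exists a homotopy H̄ : f̄ → f̄′ with F(H̄) = 0; hence the above natural map is a bijection. -/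

import Mathlib

open CategoryTheory

namespace Paper

/-- A graded object: a `ℤ`-indexed family of objects. -/
abbrev GradedObj (A : Type*) [Category A] := ℤ → A

/-- A graded map of degree `n` from `X` to `Y`. -/
abbrev GMap {A : Type*} [Category A] (X Y : GradedObj A) (n : ℤ) :=
  ∀ i : ℤ, X i ⟶ Y (i + n)

/-- Composition of graded maps, in diagrammatic order (`gcomp h f g` is "`g ∘ f`"),
with prescribed total degree `k = n + m`. -/
def gcomp {A : Type*} [Category A] {X Y Z : GradedObj A} {n m k : ℤ} (h : n + m = k)
    (f : GMap X Y n) (g : GMap Y Z m) : GMap X Z k :=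
  fun i => f i ≫ g (i + n) ≫ eqToHom (congrArg Z (show i + n + m = i + k by omega))

/-- The identity graded map of degree `0`. -/
def gid {A : Type*} [Category A] (X : GradedObj A) : GMap X X 0 :=
  fun i => eqToHom (congrArg X (add_zero i).symm)

/-- `δ(f) = d_Y ∘ f - (-1)ⁿ ⬝ f ∘ d_X` for pre-differentials `d_X`, `d_Y` and a graded
map `f` of degree `n`; the result has degree `m = n + 1`. -/
def gdelta {A : Type*} [Category A] [Preadditive A] {X Y : GradedObj A}
    (dX : GMap X X 1) (dY : GMap Y Y 1) {n m : ℤ} (h : n + 1 = m) (f : GMap X Y n) :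
    GMap X Y m :=
  gcomp h f dY - (n.negOnePow : ℤ) • gcomp (show 1 + n = m by omega) dX f

/-- The image of a graded object under a functor. -/
abbrev Fgr {A B : Type*} [Category A] [Category B] (F : B ⥤ A) (X : GradedObj B) :
    GradedObj A := fun i => F.obj (X i)

/-- The image of a graded map under a functor. -/
def Fmap {A B : Type*} [Category A] [Category B] (F : B ⥤ A) {X Y : GradedObj B} {n : ℤ}
    (f : GMap X Y n) : GMap (Fgr F X) (Fgr F Y) n := fun i => F.map (f i)

/-- `Ker(F)² = 0`: the composite of two `F`-killed morphisms vanishes. -/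
def KerSq {A B : Type*} [Category A] [Category B] [Preadditive A] [Preadditive B]
    (F : B ⥤ A) : Prop :=
  ∀ ⦃X Y Z : B⦄ (u : X ⟶ Y) (v : Y ⟶ Z), F.map u = 0 → F.map v = 0 → u ≫ v = 0

/-- `f : (X,dX) → (Y,dY)` and `g : (Y,dY) → (X,dX)` are cochain maps which are homotopy
inverse to each other. -/
def IsHomotopyEquivPair {A : Type*} [Category A] [Preadditive A] {X Y : GradedObj A}
    (dX : GMap X X 1) (dY : GMap Y Y 1) (f : GMap X Y 0) (g : GMap Y X 0) : Prop :=
  gdelta dX dY (show (0:ℤ) + 1 = 1 by omega) f = 0 ∧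
  gdelta dY dX (show (0:ℤ) + 1 = 1 by omega) g = 0 ∧
  (∃ H : GMap X X (-1), gdelta dX dX (show (-1:ℤ) + 1 = 0 by omega) H
      = gid X - gcomp (show (0:ℤ) + 0 = 0 by omega) f g) ∧
  (∃ K : GMap Y Y (-1), gdelta dY dY (show (-1:ℤ) + 1 = 0 by omega) K
      = gid Y - gcomp (show (0:ℤ) + 0 = 0 by omega) g f)


theorem gmap_eqToHom_comm {A : Type*} [Category A] {X Y : GradedObj A} {n : ℤ}
    (f : GMap X Y n) {p q : ℤ} (h : p = q) :
    eqToHom (congrArg X h) ≫ f q = f p ≫ eqToHom (congrArg (fun i => Y (i + n)) h) := by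
  subst h
  simp

theorem gcomp_assoc {A : Type*} [Category A] {X Y Z W : GradedObj A} {n m l a b k : ℤ}
    (h₁ : n + m = a) (h₂ : a + l = k) (h₃ : m + l = b) (h₄ : n + b = k)
    (f : GMap X Y n) (g : GMap Y Z m) (h : GMap Z W l) :
    gcomp h₂ (gcomp h₁ f g) h = gcomp h₄ f (gcomp h₃ g h) := by
  funext i
  simp only [gcomp, Category.assoc]
  rw [← Category.assoc (eqToHom _) (h (i + a)),
    gmap_eqToHom_comm h (show i + n + m = i + a by omega)]
  simp

section Preadditive

variable {A : Type*} [Category A] [Preadditive A] {X Y Z : GradedObj A} {n m k : ℤ}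

theorem gcomp_sub (h : n + m = k) (f : GMap X Y n) (g g' : GMap Y Z m) :
    gcomp h f (g - g') = gcomp h f g - gcomp h f g' := by
  funext i
  simp [gcomp]

theorem sub_gcomp (h : n + m = k) (f f' : GMap X Y n) (g : GMap Y Z m) :
    gcomp h (f - f') g = gcomp h f g - gcomp h f' g := by
  funext i
  simp [gcomp]

theorem gcomp_zsmul (h : n + m = k) (f : GMap X Y n) (c : ℤ) (g : GMap Y Z m) :
    gcomp h f (c • g) = c • gcomp h f g := by
  funext i
  simp [gcomp]

theorem zsmul_gcomp (h : n + m = k) (c : ℤ) (f : GMap X Y n) (g : GMap Y Z m) :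
    gcomp h (c • f) g = c • gcomp h f g := by
  funext i
  simp [gcomp]

theorem gcomp_zero (h : n + m = k) (f : GMap X Y n) :
    gcomp h f (0 : GMap Y Z m) = 0 := by
  funext i
  simp [gcomp]

theorem zero_gcomp (h : n + m = k) (g : GMap Y Z m) :
    gcomp h (0 : GMap X Y n) g = 0 := by
  funext i
  simp [gcomp]

theorem gdelta_sub (dX : GMap X X 1) (dY : GMap Y Y 1) (h : n + 1 = m) (f g : GMap X Y n) :
    gdelta dX dY h (f - g) = gdelta dX dY h f - gdelta dX dY h g := by
  simp only [gdelta, gcomp_sub, sub_gcomp, smul_sub]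
  abel

theorem gdelta_gdelta {dX : GMap X X 1} {dY : GMap Y Y 1}
    (hX : gcomp one_add_one_eq_two dX dX = 0)
    (hY : gcomp one_add_one_eq_two dY dY = 0)
    (h : n + 1 = m) (h' : m + 1 = k) (f : GMap X Y n) :
    gdelta dX dY h' (gdelta dX dY h f) = 0 := by
  have hfYY : gcomp h' (gcomp h f dY) dY = 0 := by
    rw [gcomp_assoc h h' one_add_one_eq_two (by omega), hY, gcomp_zero]
  have hXXf : gcomp (show 1 + m = k by omega) dX
      (gcomp (show 1 + n = m by omega) dX f) = 0 := by
    rw [← gcomp_assoc one_add_one_eq_two (by omega), hX, zero_gcomp]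
  have hXfY : gcomp h' (gcomp (show 1 + n = m by omega) dX f) dY
      = gcomp (show 1 + m = k by omega) dX (gcomp h f dY) :=
    gcomp_assoc _ _ _ _ _ _ _
  have hsign : (m.negOnePow : ℤ) = -(n.negOnePow : ℤ) := by
    rw [← h, Int.negOnePow_succ, Units.val_neg]
  simp only [gdelta, gcomp_sub, sub_gcomp, gcomp_zsmul, zsmul_gcomp, hfYY, hXXf, hXfY, hsign,
    smul_zero, neg_smul, sub_zero, zero_sub, sub_neg_eq_add, neg_add_cancel]

end Preadditive

section Functor

variable {A B : Type*} [Category A] [Category B] (F : B ⥤ A)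

theorem Fmap_gcomp {X Y Z : GradedObj B} {n m k : ℤ} (h : n + m = k)
    (f : GMap X Y n) (g : GMap Y Z m) :
    Fmap F (gcomp h f g) = gcomp h (Fmap F f) (Fmap F g) := by
  funext i
  simp [Fmap, gcomp, eqToHom_map]

theorem Fmap_surjective [F.Full] {X Y : GradedObj B} {n : ℤ} :
    Function.Surjective (Fmap F : GMap X Y n → GMap (Fgr F X) (Fgr F Y) n) :=
  fun f => ⟨fun i => F.preimage (f i), funext fun i => F.map_preimage (f i)⟩

variable [Preadditive A] [Preadditive B] [F.Additive]

theorem Fmap_sub {X Y : GradedObj B} {n : ℤ} (f g : GMap X Y n) :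
    Fmap F (f - g) = Fmap F f - Fmap F g := by
  funext i
  simp [Fmap]

theorem Fmap_zsmul {X Y : GradedObj B} {n : ℤ} (c : ℤ) (f : GMap X Y n) :
    Fmap F (c • f) = c • Fmap F f := by
  funext i
  simp [Fmap, F.map_zsmul]

theorem Fmap_gdelta {X Y : GradedObj B} (dX : GMap X X 1) (dY : GMap Y Y 1) {n m : ℤ}
    (h : n + 1 = m) (f : GMap X Y n) :
    Fmap F (gdelta dX dY h f) = gdelta (Fmap F dX) (Fmap F dY) h (Fmap F f) := by
  simp only [gdelta, Fmap_sub, Fmap_zsmul, Fmap_gcomp]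

end Functor

/-- Proposition `phi`: surjectivity and (under `H⁻¹Hom(C,D) = 0`)
injectivity of the natural map from homotopy classes of cochain-map lifts of `f` to
morphisms of `K(𝒞̄)` lifting the homotopy class of `f`. -/
theorem statement18 {B C : Type*} [Category B] [Preadditive B] [Category C] [Preadditive C]
    (F : B ⥤ C) [F.Additive] [F.Full] (hF : KerSq F)
    (Xb Yb : GradedObj B)
    (dC : GMap (Fgr F Xb) (Fgr F Xb) 1) (dD : GMap (Fgr F Yb) (Fgr F Yb) 1)
    (hdC : gcomp (show (1:ℤ) + 1 = 2 by omega) dC dC = 0)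
    (hdD : gcomp (show (1:ℤ) + 1 = 2 by omega) dD dD = 0)
    (dCb : GMap Xb Xb 1) (hdCb : Fmap F dCb = dC)
    (hdCbsq : gcomp (show (1:ℤ) + 1 = 2 by omega) dCb dCb = 0)
    (dDb : GMap Yb Yb 1) (hdDb : Fmap F dDb = dD)
    (hdDbsq : gcomp (show (1:ℤ) + 1 = 2 by omega) dDb dDb = 0)
    (f : GMap (Fgr F Xb) (Fgr F Yb) 0)
    (hf : gdelta dC dD (show (0:ℤ) + 1 = 1 by omega) f = 0) :
    -- surjectivity
    (∀ g : GMap (Fgr F Xb) (Fgr F Yb) 0,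
      gdelta dC dD (show (0:ℤ) + 1 = 1 by omega) g = 0 →
      (∃ H : GMap (Fgr F Xb) (Fgr F Yb) (-1),
        gdelta dC dD (show (-1:ℤ) + 1 = 0 by omega) H = g - f) →
      ∀ gb : GMap Xb Yb 0, Fmap F gb = g →
        gdelta dCb dDb (show (0:ℤ) + 1 = 1 by omega) gb = 0 →
        ∃ fb : GMap Xb Yb 0, Fmap F fb = f ∧
          gdelta dCb dDb (show (0:ℤ) + 1 = 1 by omega) fb = 0 ∧
          ∃ Hb : GMap Xb Yb (-1),
            gdelta dCb dDb (show (-1:ℤ) + 1 = 0 by omega) Hb = gb - fb ∧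
            gdelta dC dD (show (-1:ℤ) + 1 = 0 by omega) (Fmap F Hb) = g - f) ∧
    -- injectivity, assuming `H⁻¹ Hom(C,D) = 0`
    ((∀ ξ : GMap (Fgr F Xb) (Fgr F Yb) (-1),
        gdelta dC dD (show (-1:ℤ) + 1 = 0 by omega) ξ = 0 →
        ∃ η : GMap (Fgr F Xb) (Fgr F Yb) (-2),
          gdelta dC dD (show (-2:ℤ) + 1 = -1 by omega) η = ξ) →
      ∀ fb fb' : GMap Xb Yb 0,
        Fmap F fb = f → gdelta dCb dDb (show (0:ℤ) + 1 = 1 by omega) fb = 0 →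
        Fmap F fb' = f → gdelta dCb dDb (show (0:ℤ) + 1 = 1 by omega) fb' = 0 →
        (∃ Hb : GMap Xb Yb (-1),
          gdelta dCb dDb (show (-1:ℤ) + 1 = 0 by omega) Hb = fb' - fb) →
        ∃ Hb : GMap Xb Yb (-1),
          gdelta dCb dDb (show (-1:ℤ) + 1 = 0 by omega) Hb = fb' - fb ∧
          Fmap F Hb = 0) := by
  subst hdCb hdDb
  refine ⟨?_, ?_⟩
  · rintro g - ⟨H, hH⟩ gb rfl hgb
    obtain ⟨Hb, rfl⟩ := Fmap_surjective F H
    refine ⟨gb - gdelta dCb dDb (by omega) Hb, ?_, ?_, Hb, ?_, hH⟩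
    · rw [Fmap_sub, Fmap_gdelta, hH, sub_sub_cancel]
    · rw [gdelta_sub, hgb, gdelta_gdelta hdCbsq hdDbsq, sub_zero]
    · rw [sub_sub_cancel]
  · rintro hcycle fb fb' hfb - hfb' - ⟨Hb, hHb⟩
    obtain ⟨η, hη⟩ := hcycle (Fmap F Hb) (by
      rw [← Fmap_gdelta, hHb, Fmap_sub, hfb, hfb', sub_self])
    obtain ⟨ηb, rfl⟩ := Fmap_surjective F η
    refine ⟨Hb - gdelta dCb dDb (by omega) ηb, ?_, ?_⟩
    · rw [gdelta_sub, hHb, gdelta_gdelta hdCbsq hdDbsq, sub_zero]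
    · rw [Fmap_sub, Fmap_gdelta, hη, sub_self]

end Paper
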